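/- Let f : U → ℝ³ with unit normal ν be a frontal in orthogonal adapted coordinates (u,v) around a singular point of the first kind at the origin, with det(f_u, h, ν)(u,0) > 0, and assume the singular curve consists of pure-frontal singular points, i.e. Ñ(u,0) = 0 for all u. Let η̃ = −v²·F̃_v(u,0)·∂_u + ∂_v and let η̃^k f denote the k-fold iterated directional derivative of f along η̃. Then for every u with (u,0) ∈ U there exists l(u) ∈ ℝ with η̃³f(u,0) = l(u)·η̃²f(u,0), and the bias and secondary cuspidal curvature along the singular curve satisfy r_b(u) = ( |f_u|² · det(f_u, η̃²f, η̃⁴f) / |f_u × η̃²f|³ )(u,0) = 3·Ñ_v(u,0) and r_c(u) = ( |f_u|^{5/2} · det(f_u, η̃²f, 3η̃⁵f − 10l·η̃⁴f) / |f_u × η̃²f|^{7/2} )(u,0) = 12·(Ñ_vv − 4F̃_v·M̃ − 2G̃_v·Ñ_v)(u,0), where × denotes the cross product in ℝ³. -/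

import Mathlib

noncomputable section

open Matrix Set
open scoped ContDiff

abbrev V3 : Type := Fin 3 → ℝ

/-- Partial derivative in the `u`-direction. -/
def Du {E : Type*} [NormedAddCommGroup E] [NormedSpace ℝ E] (g : ℝ × ℝ → E) (p : ℝ × ℝ) : E :=
  fderiv ℝ g p (1, 0)

/-- Partial derivative in the `v`-direction. -/
def Dv {E : Type*} [NormedAddCommGroup E] [NormedSpace ℝ E] (g : ℝ × ℝ → E) (p : ℝ × ℝ) : E :=
  fderiv ℝ g p (0, 1)

def det3 (a b c : V3) : ℝ := Matrix.det (Matrix.of ![a, b, c])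

def dot (x y : V3) : ℝ := x ⬝ᵥ y

def nrm (x : V3) : ℝ := Real.sqrt (dot x x)

def cross3 (x y : V3) : V3 := crossProduct x y

structure FrontalData where
  f : ℝ × ℝ → V3
  nu : ℝ × ℝ → V3
  h : ℝ × ℝ → V3

namespace FrontalData

def Et (X : FrontalData) (p : ℝ × ℝ) : ℝ := dot (Du X.f p) (Du X.f p)
def Ft (X : FrontalData) (p : ℝ × ℝ) : ℝ := dot (Du X.f p) (X.h p)
def Gt (X : FrontalData) (p : ℝ × ℝ) : ℝ := dot (X.h p) (X.h p)
def Lt (X : FrontalData) (p : ℝ × ℝ) : ℝ := -(dot (Du X.f p) (Du X.nu p))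
def Mt (X : FrontalData) (p : ℝ × ℝ) : ℝ := -(dot (X.h p) (Du X.nu p))
def Nt (X : FrontalData) (p : ℝ × ℝ) : ℝ := -(dot (X.h p) (Dv X.nu p))

def EGF (X : FrontalData) (p : ℝ × ℝ) : ℝ := X.Et p * X.Gt p - (X.Ft p) ^ 2

/-- `f` is a frontal with unit normal `nu`, in adapted coordinates around a singular point of
the first kind at the origin: `f_v = v • h` and `{f_u, h, nu}` is a frame. -/
def IsAdapted (X : FrontalData) (U : Set (ℝ × ℝ)) : Prop :=
  IsOpen U ∧ (0, 0) ∈ U ∧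
  ContDiff ℝ ∞ X.f ∧ ContDiff ℝ ∞ X.nu ∧ ContDiff ℝ ∞ X.h ∧
  (∀ p ∈ U, dot (X.nu p) (X.nu p) = 1) ∧
  (∀ p ∈ U, dot (Du X.f p) (X.nu p) = 0) ∧
  (∀ p ∈ U, dot (Dv X.f p) (X.nu p) = 0) ∧
  (∀ p ∈ U, Dv X.f p = p.2 • X.h p) ∧
  (∀ p ∈ U, det3 (Du X.f p) (X.h p) (X.nu p) ≠ 0) ∧
  (∀ p ∈ U, 0 < X.EGF p)

/-- orthogonal adapted coordinates -/
def IsOrthogonal (X : FrontalData) (U : Set (ℝ × ℝ)) : Prop :=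
  ∀ u : ℝ, (u, 0) ∈ U → X.Et (u, 0) = 1 ∧ X.Gt (u, 0) = 1 ∧ X.Ft (u, 0) = 0

/-- Gaussian curvature on `{v ≠ 0}`. -/
def Kdef (X : FrontalData) (p : ℝ × ℝ) : ℝ :=
  (X.Lt p * X.Nt p - p.2 * (X.Mt p) ^ 2) / (p.2 * X.EGF p)

/-- Mean curvature on `{v ≠ 0}`. -/
def Hdef (X : FrontalData) (p : ℝ × ℝ) : ℝ :=
  (X.Et p * X.Nt p - 2 * p.2 * X.Ft p * X.Mt p + p.2 * X.Gt p * X.Lt p) / (2 * p.2 * X.EGF p)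

/-- Principal curvatures on `{v ≠ 0}`. -/
def kap1 (X : FrontalData) (p : ℝ × ℝ) : ℝ := X.Hdef p + Real.sqrt ((X.Hdef p) ^ 2 - X.Kdef p)
def kap2 (X : FrontalData) (p : ℝ × ℝ) : ℝ := X.Hdef p - Real.sqrt ((X.Hdef p) ^ 2 - X.Kdef p)

/-- Limiting normal curvature along the singular curve. -/
def kapNu (X : FrontalData) (u : ℝ) : ℝ := X.Lt (u, 0)
/-- Cuspidal torsion along the singular curve. -/
def kapT (X : FrontalData) (u : ℝ) : ℝ := X.Mt (u, 0)
/-- Bias along the singular curve. -/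
def rb (X : FrontalData) (u : ℝ) : ℝ := 3 * Dv X.Nt (u, 0)
/-- Secondary cuspidal curvature along the singular curve. -/
def rc (X : FrontalData) (u : ℝ) : ℝ :=
  12 * (Dv (Dv X.Nt) (u, 0) - 4 * Dv X.Ft (u, 0) * X.Mt (u, 0) -
    2 * Dv X.Gt (u, 0) * Dv X.Nt (u, 0))

end FrontalData

/-- Directional derivative of a map along the vector field `a ∂_u + ∂_v`. -/
def etaD (a : ℝ × ℝ → ℝ) (g : ℝ × ℝ → V3) : ℝ × ℝ → V3 :=
  fun p => a p • Du g p + Dv g p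

section Calculus

variable {E : Type*} [NormedAddCommGroup E] [NormedSpace ℝ E]

lemma contDiff_Du {g : ℝ × ℝ → E} (hg : ContDiff ℝ ∞ g) : ContDiff ℝ ∞ (Du g) :=
  (hg.fderiv_right (m := ∞) (by simp)).clm_apply contDiff_const

lemma contDiff_Dv {g : ℝ × ℝ → E} (hg : ContDiff ℝ ∞ g) : ContDiff ℝ ∞ (Dv g) :=
  (hg.fderiv_right (m := ∞) (by simp)).clm_apply contDiff_const

lemma differentiableAt_of_contDiff {g : ℝ × ℝ → E} (hg : ContDiff ℝ ∞ g) (p : ℝ × ℝ) :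
    DifferentiableAt ℝ g p :=
  (hg.differentiable (by simp)) p

lemma Du_eqOn {U : Set (ℝ × ℝ)} (hU : IsOpen U) {g k : ℝ × ℝ → E} (h : EqOn g k U) :
    EqOn (Du g) (Du k) U := fun p hp => by
  simp only [Du, (h.eventuallyEq_of_mem (hU.mem_nhds hp)).fderiv_eq]

lemma Dv_eqOn {U : Set (ℝ × ℝ)} (hU : IsOpen U) {g k : ℝ × ℝ → E} (h : EqOn g k U) :
    EqOn (Dv g) (Dv k) U := fun p hp => by
  simp only [Dv, (h.eventuallyEq_of_mem (hU.mem_nhds hp)).fderiv_eq]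

lemma Dv_const (c : E) (p : ℝ × ℝ) : Dv (fun _ => c) p = 0 := by
  simp [Dv]

lemma Dv_add {g k : ℝ × ℝ → E} (hg : ContDiff ℝ ∞ g) (hk : ContDiff ℝ ∞ k) (p : ℝ × ℝ) :
    Dv (fun q => g q + k q) p = Dv g p + Dv k p := by
  simp [Dv, fderiv_fun_add (differentiableAt_of_contDiff hg p) (differentiableAt_of_contDiff hk p)]

lemma Du_add {g k : ℝ × ℝ → E} (hg : ContDiff ℝ ∞ g) (hk : ContDiff ℝ ∞ k) (p : ℝ × ℝ) :
    Du (fun q => g q + k q) p = Du g p + Du k p := by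
  simp [Du, fderiv_fun_add (differentiableAt_of_contDiff hg p) (differentiableAt_of_contDiff hk p)]

lemma Dv_neg (g : ℝ × ℝ → E) (p : ℝ × ℝ) : Dv (fun q => -g q) p = -Dv g p := by
  simp [Dv, fderiv_fun_neg]

lemma Du_smul {c : ℝ × ℝ → ℝ} {g : ℝ × ℝ → E} (hc : ContDiff ℝ ∞ c) (hg : ContDiff ℝ ∞ g)
    (p : ℝ × ℝ) : Du (fun q => c q • g q) p = c p • Du g p + Du c p • g p := by
  simp [Du, fderiv_fun_smul (differentiableAt_of_contDiff hc p) (differentiableAt_of_contDiff hg p)]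

lemma Dv_smul {c : ℝ × ℝ → ℝ} {g : ℝ × ℝ → E} (hc : ContDiff ℝ ∞ c) (hg : ContDiff ℝ ∞ g)
    (p : ℝ × ℝ) : Dv (fun q => c q • g q) p = c p • Dv g p + Dv c p • g p := by
  simp [Dv, fderiv_fun_smul (differentiableAt_of_contDiff hc p) (differentiableAt_of_contDiff hg p)]

lemma Dv_const_smul (c : ℝ) {g : ℝ × ℝ → E} (hg : ContDiff ℝ ∞ g) (p : ℝ × ℝ) :
    Dv (fun q => c • g q) p = c • Dv g p := by
  rw [Dv_smul contDiff_const hg, Dv_const, zero_smul, add_zero]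

lemma Du_snd_pow (n : ℕ) (p : ℝ × ℝ) : Du (fun q : ℝ × ℝ => q.2 ^ n) p = 0 := by
  have h := (hasFDerivAt_snd (𝕜 := ℝ) (p := p)).pow n
  simp [Du, h.fderiv]

lemma Dv_snd_pow (n : ℕ) (p : ℝ × ℝ) :
    Dv (fun q : ℝ × ℝ => q.2 ^ n) p = n * p.2 ^ (n - 1) := by
  have h := (hasFDerivAt_snd (𝕜 := ℝ) (p := p)).pow n
  simp [Dv, h.fderiv]

lemma Du_snd_pow_smul (n : ℕ) {g : ℝ × ℝ → E} (hg : ContDiff ℝ ∞ g) (p : ℝ × ℝ) :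
    Du (fun q => q.2 ^ n • g q) p = p.2 ^ n • Du g p := by
  rw [Du_smul (by fun_prop) hg, Du_snd_pow, zero_smul, add_zero]

lemma Dv_snd_pow_smul (n : ℕ) {g : ℝ × ℝ → E} (hg : ContDiff ℝ ∞ g) (p : ℝ × ℝ) :
    Dv (fun q => q.2 ^ n • g q) p = p.2 ^ n • Dv g p + (n * p.2 ^ (n - 1)) • g p := by
  rw [Dv_smul (by fun_prop) hg, Dv_snd_pow]

lemma Du_snd_smul {g : ℝ × ℝ → E} (hg : ContDiff ℝ ∞ g) (p : ℝ × ℝ) :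
    Du (fun q => q.2 • g q) p = p.2 • Du g p := by
  simpa using Du_snd_pow_smul 1 hg p

lemma Dv_snd_smul {g : ℝ × ℝ → E} (hg : ContDiff ℝ ∞ g) (p : ℝ × ℝ) :
    Dv (fun q => q.2 • g q) p = p.2 • Dv g p + g p := by
  simpa using Dv_snd_pow_smul 1 hg p

lemma Dv_comp_fst {c : ℝ → ℝ} (hc : ContDiff ℝ ∞ c) (p : ℝ × ℝ) :
    Dv (fun q : ℝ × ℝ => c q.1) p = 0 := by
  have h := (((hc.differentiable (by simp)) p.1).hasFDerivAt).comp p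
    (hasFDerivAt_fst (𝕜 := ℝ) (p := p))
  have h' : fderiv ℝ (fun q : ℝ × ℝ => c q.1) p = _ := h.fderiv
  simp [Dv, h']

lemma Dv_Du_comm {g : ℝ × ℝ → E} (hg : ContDiff ℝ ∞ g) (p : ℝ × ℝ) :
    Dv (Du g) p = Du (Dv g) p := by
  have hd : DifferentiableAt ℝ (fderiv ℝ g) p :=
    differentiableAt_of_contDiff (hg.fderiv_right (m := ∞) (by simp)) p
  have hs := (hg.contDiffAt (x := p)).isSymmSndFDerivAt
    (by simpa using WithTop.coe_le_coe.2 (le_top : (2 : ℕ∞) ≤ ⊤))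
  have e : ∀ w : ℝ × ℝ, fderiv ℝ (fun q => fderiv ℝ g q w) p =
      (fderiv ℝ (fderiv ℝ g) p).flip w := fun w => by
    simpa using (hd.hasFDerivAt.clm_apply (hasFDerivAt_const w p)).fderiv
  change fderiv ℝ (fun q => fderiv ℝ g q (1, 0)) p (0, 1) =
    fderiv ℝ (fun q => fderiv ℝ g q (0, 1)) p (1, 0)
  rw [e, e]
  exact hs.eq _ _

end Calculus

section Dot

lemma contDiff_dot {g k : ℝ × ℝ → V3} (hg : ContDiff ℝ ∞ g) (hk : ContDiff ℝ ∞ k) :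
    ContDiff ℝ ∞ (fun p => dot (g p) (k p)) := by
  simp only [dot, dotProduct]
  fun_prop

lemma Du_apply {g : ℝ × ℝ → V3} (hg : ContDiff ℝ ∞ g) (p : ℝ × ℝ) (i : Fin 3) :
    Du g p i = Du (fun q => g q i) p := by
  simp [Du, fderiv_apply (differentiableAt_of_contDiff hg p)]

lemma Dv_apply {g : ℝ × ℝ → V3} (hg : ContDiff ℝ ∞ g) (p : ℝ × ℝ) (i : Fin 3) :
    Dv g p i = Dv (fun q => g q i) p := by
  simp [Dv, fderiv_apply (differentiableAt_of_contDiff hg p)]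

lemma Du_dot {g k : ℝ × ℝ → V3} (hg : ContDiff ℝ ∞ g) (hk : ContDiff ℝ ∞ k) (p : ℝ × ℝ) :
    Du (fun q => dot (g q) (k q)) p = dot (Du g p) (k p) + dot (g p) (Du k p) := by
  have hg' := fun i => contDiff_pi.1 hg i
  have hk' := fun i => contDiff_pi.1 hk i
  have hm : ∀ i, Du (fun q => g q i * k q i) p = g p i * Du k p i + Du g p i * k p i := fun i => by
    rw [Du_apply hg, Du_apply hk]; exact Du_smul (hg' i) (hk' i) p
  simp only [dot, dotProduct, Fin.sum_univ_three]
  rw [Du_add (by fun_prop) (by fun_prop), Du_add (by fun_prop) (by fun_prop), hm, hm, hm]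
  ring

lemma Dv_dot {g k : ℝ × ℝ → V3} (hg : ContDiff ℝ ∞ g) (hk : ContDiff ℝ ∞ k) (p : ℝ × ℝ) :
    Dv (fun q => dot (g q) (k q)) p = dot (Dv g p) (k p) + dot (g p) (Dv k p) := by
  have hg' := fun i => contDiff_pi.1 hg i
  have hk' := fun i => contDiff_pi.1 hk i
  have hm : ∀ i, Dv (fun q => g q i * k q i) p = g p i * Dv k p i + Dv g p i * k p i := fun i => by
    rw [Dv_apply hg, Dv_apply hk]; exact Dv_smul (hg' i) (hk' i) p
  simp only [dot, dotProduct, Fin.sum_univ_three]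
  rw [Dv_add (by fun_prop) (by fun_prop), Dv_add (by fun_prop) (by fun_prop), hm, hm, hm]
  ring

lemma dot_comm (x y : V3) : dot x y = dot y x := dotProduct_comm x y

lemma dot_add_left (x y z : V3) : dot (x + y) z = dot x z + dot y z := add_dotProduct x y z

lemma dot_sub_left (x y z : V3) : dot (x - y) z = dot x z - dot y z := sub_dotProduct x y z

lemma dot_smul_left (c : ℝ) (x y : V3) : dot (c • x) y = c * dot x y := smul_dotProduct c x y

lemma dot_zero (x : V3) : dot x 0 = 0 := dotProduct_zero x

lemma zero_dot (x : V3) : dot 0 x = 0 := zero_dotProduct x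

/-- A vector is the sum of its components along an orthonormal frame. -/
lemma eq_frame_expansion {e h n : V3} (hee : dot e e = 1) (hhh : dot h h = 1) (hnn : dot n n = 1)
    (heh : dot e h = 0) (hen : dot e n = 0) (hhn : dot h n = 0) (x : V3) :
    x = dot x e • e + dot x h • h + dot x n • n := by
  set Q : Matrix (Fin 3) (Fin 3) ℝ := Matrix.of ![e, h, n] with hQ
  have h1 : Q * Qᵀ = 1 := by
    ext i j
    change dot (![e, h, n] i) (![e, h, n] j) = _
    fin_cases i <;> fin_cases j <;> simp [hee, hhh, hnn, heh, hen, hhn, dot_comm h e, dot_comm n e,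
      dot_comm n h]
  have h2 : Qᵀ * Q = 1 := mul_eq_one_comm.1 h1
  have h3 : x ᵥ* Qᵀ ᵥ* Q = x := by rw [vecMul_vecMul, h2, vecMul_one]
  rw [← h3]
  nth_rewrite 2 [h3]
  nth_rewrite 2 [h3]
  nth_rewrite 2 [h3]
  ext i
  simp [vecMul, dotProduct, Fin.sum_univ_three, hQ, dot]

lemma det3_eq_dot {e h n : V3} (hee : dot e e = 1) (hhh : dot h h = 1) (hnn : dot n n = 1)
    (heh : dot e h = 0) (hen : dot e n = 0) (hhn : dot h n = 0) (hpos : 0 < det3 e h n) (x : V3) :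
    det3 e h x = dot x n := by
  have h1 : (Matrix.of ![e, h, n]) * (Matrix.of ![e, h, n])ᵀ = 1 := by
    ext i j
    change dot (![e, h, n] i) (![e, h, n] j) = _
    fin_cases i <;> fin_cases j <;> simp [hee, hhh, hnn, heh, hen, hhn, dot_comm h e, dot_comm n e,
      dot_comm n h]
  have h2 : det3 e h n * det3 e h n = 1 := by
    have := congrArg Matrix.det h1
    rwa [Matrix.det_mul, Matrix.det_transpose, Matrix.det_one] at this
  have h3 : det3 e h n = 1 := by nlinarith
  have h4 : det3 e h (dot x e • e + dot x h • h + dot x n • n) = dot x n * det3 e h n := by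
    generalize dot x e = r, dot x h = s, dot x n = t
    simp [det3, Matrix.det_fin_three]
    ring
  rw [eq_frame_expansion hee hhh hnn heh hen hhn x, h4, h3, mul_one,
    ← eq_frame_expansion hee hhh hnn heh hen hhn x]

lemma dot_cross3_self (x y : V3) :
    dot (cross3 x y) (cross3 x y) = dot x x * dot y y - dot x y ^ 2 := by
  simp [cross3, dot, cross_apply, dotProduct, Fin.sum_univ_three]
  ring

end Dot

section Expansion

variable {U : Set (ℝ × ℝ)} {c : ℝ → ℝ} {a : ℝ × ℝ → ℝ}

/-- Effect of `-v² c(u) ∂_u + ∂_v` on an expansion in powers of `v`. -/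
lemma etaD_eqOn_expansion (hU : IsOpen U) (hc : ContDiff ℝ ∞ c)
    (ha : ∀ p : ℝ × ℝ, a p = -(p.2 ^ 2) * c p.1) {g C₀ C₁ C₂ C₃ C₄ : ℝ × ℝ → V3}
    (h₀ : ContDiff ℝ ∞ C₀) (h₁ : ContDiff ℝ ∞ C₁) (h₂ : ContDiff ℝ ∞ C₂)
    (h₃ : ContDiff ℝ ∞ C₃) (h₄ : ContDiff ℝ ∞ C₄)
    (hg : EqOn g (fun p => C₀ p + p.2 • C₁ p + p.2 ^ 2 • C₂ p + p.2 ^ 3 • C₃ p +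
      p.2 ^ 4 • C₄ p) U) :
    ∃ D₃ D₄ : ℝ × ℝ → V3, ContDiff ℝ ∞ D₃ ∧ ContDiff ℝ ∞ D₄ ∧
      (∀ p, D₃ p = Dv C₃ p + (4 : ℝ) • C₄ p + (-c p.1) • Du C₁ p) ∧
      EqOn (etaD a g) (fun p => (Dv C₀ p + C₁ p) + p.2 • (Dv C₁ p + (2 : ℝ) • C₂ p) +
        p.2 ^ 2 • (Dv C₂ p + (3 : ℝ) • C₃ p + (-c p.1) • Du C₀ p) + p.2 ^ 3 • D₃ p +
        p.2 ^ 4 • D₄ p) U := by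
  have := contDiff_Dv h₃
  have := contDiff_Dv h₄
  have := contDiff_Du h₁
  have := contDiff_Du h₂
  have := contDiff_Du h₃
  have := contDiff_Du h₄
  refine ⟨fun p => Dv C₃ p + (4 : ℝ) • C₄ p + (-c p.1) • Du C₁ p,
    fun p => Dv C₄ p + (-c p.1) • (Du C₂ p + p.2 • Du C₃ p + p.2 ^ 2 • Du C₄ p),
    by fun_prop, by fun_prop, fun _ => rfl, fun p hp => ?_⟩
  have hu := Du_eqOn hU hg hp
  have hv := Dv_eqOn hU hg hp
  rw [Du_add (by fun_prop) (by fun_prop), Du_add (by fun_prop) (by fun_prop),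
    Du_add (by fun_prop) (by fun_prop), Du_add (by fun_prop) (by fun_prop), Du_snd_smul h₁,
    Du_snd_pow_smul 2 h₂, Du_snd_pow_smul 3 h₃, Du_snd_pow_smul 4 h₄] at hu
  rw [Dv_add (by fun_prop) (by fun_prop), Dv_add (by fun_prop) (by fun_prop),
    Dv_add (by fun_prop) (by fun_prop), Dv_add (by fun_prop) (by fun_prop), Dv_snd_smul h₁,
    Dv_snd_pow_smul 2 h₂, Dv_snd_pow_smul 3 h₃, Dv_snd_pow_smul 4 h₄] at hv
  simp only [etaD, hu, hv, ha]
  push_cast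
  module

/-- Values on `v = 0` of the iterated derivatives of a map with `g_v = v • h`. -/
lemma etaD_iterates_of_Dv_eq (hU : IsOpen U) (hc : ContDiff ℝ ∞ c)
    (ha : ∀ p : ℝ × ℝ, a p = -(p.2 ^ 2) * c p.1) {g h : ℝ × ℝ → V3}
    (hg : ContDiff ℝ ∞ g) (hh : ContDiff ℝ ∞ h) (hgh : ∀ p ∈ U, Dv g p = p.2 • h p)
    {u : ℝ} (hu : (u, 0) ∈ U) :
    etaD a (etaD a g) (u, 0) = h (u, 0) ∧
    etaD a (etaD a (etaD a g)) (u, 0) = (2 : ℝ) • Dv h (u, 0) - (2 * c u) • Du g (u, 0) ∧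
    etaD a (etaD a (etaD a (etaD a g))) (u, 0) = (3 : ℝ) • Dv (Dv h) (u, 0) ∧
    etaD a (etaD a (etaD a (etaD a (etaD a g)))) (u, 0) =
      (4 : ℝ) • Dv (Dv (Dv h)) (u, 0) - (20 * c u) • Du h (u, 0) := by
  have hDg := contDiff_Du hg
  have hB := contDiff_Dv hh
  have hBB := contDiff_Dv hB
  have hA := contDiff_Du hh
  -- `k` is the `v²`-coefficient of the first derivative
  set k : ℝ × ℝ → V3 := fun p => (-c p.1) • Du g p with hk
  have hks : ContDiff ℝ ∞ k := by fun_prop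
  have hBk := contDiff_Dv hks
  have hBBk := contDiff_Dv hBk
  have hguv : ∀ p ∈ U, Dv (Du g) p = p.2 • Du h p := fun p hp => by
    rw [Dv_Du_comm hg, Du_eqOn hU (k := fun p => p.2 • h p) hgh hp, Du_snd_smul hh]
  have hDk : EqOn (Dv k) (fun p => p.2 • ((-c p.1) • Du h p)) U := fun p hp => by
    have := Dv_comp_fst (c := fun x => -c x) (by fun_prop) p
    simp only [hk]
    rw [Dv_smul (by fun_prop) hDg, this, hguv p hp]
    module
  have hk0 : Dv k (u, 0) = 0 := by simp [hDk hu]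
  have hk1 : Dv (Dv k) (u, 0) = (-c u) • Du h (u, 0) := by
    rw [Dv_eqOn hU hDk hu, Dv_snd_smul (by fun_prop)]; simp
  have e1 : EqOn (etaD a g) (fun p => (fun _ => (0 : V3)) p + p.2 • h p + p.2 ^ 2 • k p +
      p.2 ^ 3 • (fun _ => (0 : V3)) p + p.2 ^ 4 • (fun _ => (0 : V3)) p) U := fun p hp => by
    simp only [etaD, hgh p hp, ha, hk]
    module
  obtain ⟨D₃, D₄, hD₃, hD₄, hD, e2⟩ := etaD_eqOn_expansion hU hc ha contDiff_const hh hks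
    contDiff_const contDiff_const e1
  have hDu0 : ∀ p : ℝ × ℝ, Du (fun _ => (0 : V3)) p = 0 := fun p => by simp [Du]
  simp only [Dv_const, hDu0, smul_zero, zero_add, add_zero] at e2 hD
  obtain ⟨F₃, F₄, hF₃, hF₄, -, e3⟩ := etaD_eqOn_expansion hU hc ha hh
    (C₁ := fun p => Dv h p + (2 : ℝ) • k p) (C₂ := Dv k) (by fun_prop) hBk hD₃ hD₄ e2
  obtain ⟨G₃, G₄, hG₃, hG₄, -, e4⟩ := etaD_eqOn_expansion hU hc ha
    (C₀ := fun p => Dv h p + (Dv h p + (2 : ℝ) • k p))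
    (C₁ := fun p => Dv (fun p => Dv h p + (2 : ℝ) • k p) p + (2 : ℝ) • Dv k p)
    (C₂ := fun p => Dv (Dv k) p + (3 : ℝ) • D₃ p + (-c p.1) • Du h p)
    (by fun_prop) ((contDiff_Dv (by fun_prop)).add (by fun_prop)) (by fun_prop) hF₃ hF₄ e3
  have d1 : Dv (fun p => Dv h p + (2 : ℝ) • k p) = fun p => Dv (Dv h) p + (2 : ℝ) • Dv k p := by
    funext p
    rw [Dv_add hB (by fun_prop), Dv_const_smul 2 hks]
  have d0 : Dv (fun p => Dv h p + (Dv h p + (2 : ℝ) • k p)) =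
      fun p => (2 : ℝ) • Dv (Dv h) p + (2 : ℝ) • Dv k p := by
    funext p
    rw [Dv_add hB (by fun_prop), d1]
    module
  have d2 : Dv (fun p => Dv (Dv h) p + (2 : ℝ) • Dv k p + (2 : ℝ) • Dv k p) =
      fun p => Dv (Dv (Dv h)) p + (4 : ℝ) • Dv (Dv k) p := by
    funext p
    rw [Dv_add (by fun_prop) (by fun_prop), Dv_add (by fun_prop) (by fun_prop),
      Dv_const_smul 2 hBk]
    module
  simp only [d0, d1, d2] at e4
  have hBBB := contDiff_Dv hBB
  have hE₀ : ContDiff ℝ ∞ (fun p => Dv h p + (Dv h p + (2 : ℝ) • k p)) := by fun_prop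
  have hE₂ : ContDiff ℝ ∞ (fun p => Dv (Dv k) p + (3 : ℝ) • D₃ p + (-c p.1) • Du h p) := by
    fun_prop
  have hcs : ContDiff ℝ ∞ (fun p : ℝ × ℝ => -c p.1) := by fun_prop
  have hC₂ : ContDiff ℝ ∞ (fun p => Dv (fun p => Dv (Dv k) p + (3 : ℝ) • D₃ p +
      (-c p.1) • Du h p) p + (3 : ℝ) • F₃ p +
      (-c p.1) • Du (fun p => Dv h p + (Dv h p + (2 : ℝ) • k p)) p) :=
    ((contDiff_Dv hE₂).add (by fun_prop)).add (hcs.smul (contDiff_Du hE₀))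
  obtain ⟨_, _, -, -, -, e5⟩ := etaD_eqOn_expansion hU hc ha
    (C₀ := fun p => (2 : ℝ) • Dv (Dv h) p + (2 : ℝ) • Dv k p +
      (Dv (Dv h) p + (2 : ℝ) • Dv k p + (2 : ℝ) • Dv k p))
    (C₁ := fun p => Dv (Dv (Dv h)) p + (4 : ℝ) • Dv (Dv k) p +
      (2 : ℝ) • (Dv (Dv k) p + (3 : ℝ) • D₃ p + (-c p.1) • Du h p))
    (by fun_prop) (by fun_prop) hC₂ hG₃ hG₄ e4
  have d3 : Dv (fun p => (2 : ℝ) • Dv (Dv h) p + (2 : ℝ) • Dv k p +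
      (Dv (Dv h) p + (2 : ℝ) • Dv k p + (2 : ℝ) • Dv k p)) (u, 0) =
      (3 : ℝ) • Dv (Dv (Dv h)) (u, 0) + (6 : ℝ) • Dv (Dv k) (u, 0) := by
    rw [Dv_add (by fun_prop) (by fun_prop), d2, Dv_add (by fun_prop) (by fun_prop),
      Dv_const_smul 2 hBk, Dv_const_smul 2 hBB]
    module
  have hDu : D₃ (u, 0) = (-c u) • Du h (u, 0) := by simp [hD]
  refine ⟨by simp [e2 hu], ?_, ?_, ?_⟩
  · rw [e3 hu]
    simp only [hk]
    module
  · rw [e4 hu]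
    simp only [hk0]
    module
  · rw [e5 hu]
    simp only [d3, hDu, hk1]
    module

end Expansion

/-- along a singular curve of pure-frontal singular points, with
`η̃ = (-v² F̃_v(u,0)) ∂_u + ∂_v`, for every `u` there is `l(u)` with `η̃³f = l·η̃²f` at `(u,0)`,
and the bias and secondary cuspidal curvature along the singular curve satisfy
`r_b(u) = 3Ñ_v(u,0)` and `r_c(u) = 12(Ñ_vv − 4F̃_v M̃ − 2G̃_v Ñ_v)(u,0)`. -/
theorem stmt2 (X : FrontalData) (U : Set (ℝ × ℝ))
    (hA : X.IsAdapted U) (hO : X.IsOrthogonal U)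
    (hdetpos : ∀ u : ℝ, (u, 0) ∈ U →
      0 < det3 (Du X.f (u, 0)) (X.h (u, 0)) (X.nu (u, 0)))
    (hpure : ∀ u : ℝ, (u, 0) ∈ U → X.Nt (u, 0) = 0)
    (a : ℝ × ℝ → ℝ) (ha : ∀ p : ℝ × ℝ, a p = -(p.2 ^ 2) * Dv X.Ft (p.1, 0)) :
    ∀ u : ℝ, (u, 0) ∈ U → ∃ l : ℝ,
      etaD a (etaD a (etaD a X.f)) (u, 0) = l • etaD a (etaD a X.f) (u, 0) ∧
      (nrm (Du X.f (u, 0))) ^ 2 *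
          det3 (Du X.f (u, 0)) (etaD a (etaD a X.f) (u, 0))
            (etaD a (etaD a (etaD a (etaD a X.f))) (u, 0)) /
          (nrm (cross3 (Du X.f (u, 0)) (etaD a (etaD a X.f) (u, 0)))) ^ 3
        = 3 * Dv X.Nt (u, 0) ∧
      (nrm (Du X.f (u, 0))) ^ ((5 : ℝ) / 2) *
          det3 (Du X.f (u, 0)) (etaD a (etaD a X.f) (u, 0))
            ((3 : ℝ) • etaD a (etaD a (etaD a (etaD a (etaD a X.f)))) (u, 0) -
              (10 * l) • etaD a (etaD a (etaD a (etaD a X.f))) (u, 0)) /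
          (nrm (cross3 (Du X.f (u, 0)) (etaD a (etaD a X.f) (u, 0)))) ^ ((7 : ℝ) / 2)
        = 12 * (Dv (Dv X.Nt) (u, 0) - 4 * Dv X.Ft (u, 0) * X.Mt (u, 0) -
            2 * Dv X.Gt (u, 0) * Dv X.Nt (u, 0)) := by
  obtain ⟨hU, -, hf, hn, hh, hnn, hen, hfn, hfv, -, -⟩ := hA
  intro u hu
  have he := contDiff_Du hf
  have hh1 := contDiff_Dv hh
  have hh2 := contDiff_Dv hh1
  have hn1 := contDiff_Dv hn
  have hn2 := contDiff_Dv hn1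
  have hhu := contDiff_Du hh
  have hFt : ContDiff ℝ ∞ X.Ft := contDiff_dot he hh
  have hc : ContDiff ℝ ∞ (fun x : ℝ => Dv X.Ft (x, 0)) :=
    (contDiff_Dv hFt).comp (contDiff_id.prodMk contDiff_const)
  obtain ⟨i2, i3, i4, i5⟩ := etaD_iterates_of_Dv_eq hU hc ha hf hh hfv hu
  -- orthonormality of the frame along the singular curve
  obtain ⟨oee, ohh, oeh⟩ := hO u hu
  have onn := hnn _ hu
  have oen := hen _ hu
  have hpos := hdetpos u hu
  have hN := hpure u hu
  have ehn : EqOn (fun p => dot (X.h p) (X.nu p)) (fun _ => (0 : ℝ)) U := by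
    have hs : EqOn (fun p => p.2 • dot (X.h p) (X.nu p)) (fun _ => (0 : ℝ)) U := fun p hp => by
      have h1 := hfn p hp
      rwa [hfv p hp, dot_smul_left] at h1
    intro p hp
    have h0 := hs hp
    have h1 := Dv_eqOn hU hs hp
    rw [Dv_snd_smul (contDiff_dot hh hn), Dv_const] at h1
    simp only [smul_eq_mul, mul_eq_zero] at h0
    rcases h0 with h0 | h0
    · simpa [h0] using h1
    · exact h0
  have ohn := ehn hu
  -- derivatives of the orthogonality relations
  have hhn1 : EqOn (fun p => dot (Dv X.h p) (X.nu p) + dot (X.h p) (Dv X.nu p))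
      (fun _ => (0 : ℝ)) U := fun p hp => by
    have h1 := Dv_eqOn hU ehn hp
    rwa [Dv_dot hh hn, Dv_const] at h1
  have hhn2 : EqOn (fun p => (dot (Dv (Dv X.h) p) (X.nu p) + dot (Dv X.h p) (Dv X.nu p)) +
      (dot (Dv X.h p) (Dv X.nu p) + dot (X.h p) (Dv (Dv X.nu) p)))
      (fun _ => (0 : ℝ)) U := fun p hp => by
    have h1 := Dv_eqOn hU hhn1 hp
    rwa [Dv_add (contDiff_dot hh1 hn) (contDiff_dot hh hn1), Dv_dot hh1 hn, Dv_dot hh hn1,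
      Dv_const] at h1
  have hhn3 := Dv_eqOn hU hhn2 hu
  rw [Dv_add ((contDiff_dot hh2 hn).add (contDiff_dot hh1 hn1))
    ((contDiff_dot hh1 hn1).add (contDiff_dot hh hn2)),
    Dv_add (contDiff_dot hh2 hn) (contDiff_dot hh1 hn1),
    Dv_add (contDiff_dot hh1 hn1) (contDiff_dot hh hn2), Dv_dot hh2 hn, Dv_dot hh1 hn1,
    Dv_dot hh hn2, Dv_const] at hhn3
  have hhnu := Du_eqOn hU ehn hu
  rw [Du_dot hh hn] at hhnu
  have hnn1 := Dv_eqOn hU (k := fun _ => (1 : ℝ)) hnn hu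
  rw [Dv_dot hn hn, Dv_const] at hnn1
  have hfuv : ∀ p ∈ U, Dv (Du X.f) p = p.2 • Du X.h p := fun p hp => by
    rw [Dv_Du_comm hf, Du_eqOn hU (k := fun p => p.2 • X.h p) hfv hp, Du_snd_smul hh]
  have hen1 : EqOn (fun p => p.2 • dot (Du X.h p) (X.nu p) + dot (Du X.f p) (Dv X.nu p))
      (fun _ => (0 : ℝ)) U := fun p hp => by
    have h1 := Dv_eqOn hU (k := fun _ => (0 : ℝ)) hen hp
    rwa [Dv_dot he hn, Dv_const, hfuv p hp, dot_smul_left] at h1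
  have hen2 := Dv_eqOn hU hen1 hu
  have hsm : ContDiff ℝ ∞ (fun p : ℝ × ℝ => p.2 • dot (Du X.h p) (X.nu p)) :=
    contDiff_snd.smul (contDiff_dot hhu hn)
  rw [Dv_add hsm (contDiff_dot he hn1),
    Dv_snd_smul (contDiff_dot hhu hn), Dv_dot he hn1, Dv_const, hfuv _ hu] at hen2
  replace hhn1 := hhn1 hu
  replace hhn2 := hhn2 hu
  replace hen1 := hen1 hu
  -- derivatives of the fundamental quantities
  have hφ : Dv X.Ft (u, 0) = dot (Dv X.h (u, 0)) (Du X.f (u, 0)) := by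
    rw [dot_comm]
    change Dv (fun p => dot (Du X.f p) (X.h p)) (u, 0) = _
    rw [Dv_dot he hh, hfuv _ hu, zero_smul, zero_dot, zero_add]
  have hG : Dv X.Gt (u, 0) = 2 * dot (Dv X.h (u, 0)) (X.h (u, 0)) := by
    change Dv (fun p => dot (X.h p) (X.h p)) (u, 0) = _
    rw [Dv_dot hh hh, dot_comm (X.h _) (Dv X.h _), two_mul]
  have hNv : Dv X.Nt = fun p => -(dot (Dv X.h p) (Dv X.nu p) + dot (X.h p) (Dv (Dv X.nu) p)) := by
    funext p
    change Dv (fun p => -(dot (X.h p) (Dv X.nu p))) p = _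
    rw [Dv_neg, Dv_dot hh hn1]
  have hNvv : Dv (Dv X.Nt) (u, 0) =
      -((dot (Dv (Dv X.h) (u, 0)) (Dv X.nu (u, 0)) + dot (Dv X.h (u, 0)) (Dv (Dv X.nu) (u, 0))) +
        (dot (Dv X.h (u, 0)) (Dv (Dv X.nu) (u, 0)) +
          dot (X.h (u, 0)) (Dv (Dv (Dv X.nu)) (u, 0)))) := by
    rw [hNv, Dv_neg, Dv_add (contDiff_dot hh1 hn1) (contDiff_dot hh hn2), Dv_dot hh1 hn1,
      Dv_dot hh hn2]
  have hNv0 := congrFun hNv (u, 0)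
  have hDu0 : Du (fun _ : ℝ × ℝ => (0 : ℝ)) (u, 0) = 0 := by simp [Du]
  rw [hDu0] at hhnu
  simp only [FrontalData.Et, FrontalData.Gt, FrontalData.Ft, FrontalData.Nt] at oee ohh oeh hN
  rw [hG, hNvv, hNv0, i2, i3, i4, i5, hφ, FrontalData.Mt]
  clear hφ hG hNv hNvv hNv0 i2 i3 i4 i5 ha hc hfv hfn hdetpos hpure hfuv ehn
  dsimp only at ohn hhn1 hhn2 hhn3 hhnu hnn1 hen1 hen2
  clear hf hn hh he hh1 hh2 hn1 hn2 hhu hFt hO hnn hen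
  generalize Du X.f (u, 0) = e, Du X.h (u, 0) = hu', Du X.nu (u, 0) = nu',
    Dv (Dv (Dv X.h)) (u, 0) = h3, Dv (Dv X.h) (u, 0) = h2, Dv X.h (u, 0) = h1, X.h (u, 0) = h,
    Dv (Dv (Dv X.nu)) (u, 0) = n3, Dv (Dv X.nu) (u, 0) = n2, Dv X.nu (u, 0) = n1, X.nu (u, 0) = n at *
  have exp := eq_frame_expansion oee ohh onn oeh oen ohn
  have hdet := det3_eq_dot oee ohh onn oeh oen ohn hpos
  have hn1e : n1 = 0 := by
    have k1 : dot n1 e = 0 := by rw [dot_comm]; simpa using hen1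
    have k2 : dot n1 h = 0 := by rw [dot_comm]; linarith
    have k3 : dot n1 n = 0 := by rw [dot_comm n n1] at hnn1; linarith
    rw [exp n1, k1, k2, k3]
    module
  subst hn1e
  simp only [dot_zero, zero_dot, zero_smul, zero_add, add_zero] at *
  have hh1e := exp h1
  rw [hhn1, zero_smul, add_zero] at hh1e
  have hh1n2 : dot h1 n2 = dot h1 e * dot e n2 + dot h1 h * dot h n2 := by
    conv_lhs => rw [hh1e]
    rw [dot_add_left, dot_smul_left, dot_smul_left]
  have hnrm : nrm e = 1 := by rw [nrm, oee, Real.sqrt_one]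
  have hcross : nrm (cross3 e h) = 1 := by
    rw [nrm, dot_cross3_self, oee, ohh, oeh]; norm_num
  refine ⟨2 * dot h1 h, ?_, ?_, ?_⟩
  · rw [congrArg (fun x => (2 : ℝ) • x) hh1e]
    module
  · rw [hdet, hnrm, hcross, dot_smul_left]
    linarith
  · rw [hdet, hnrm, hcross, Real.one_rpow, Real.one_rpow]
    simp only [dot_smul_left, dot_sub_left]
    have r1 : dot h2 n = -dot h n2 := by linarith
    have r2 : dot hu' n = -dot h nu' := by linarith
    have r3 : dot e n2 = dot h nu' := by linarith
    have r4 : dot h3 n = -3 * dot h1 n2 - dot h n3 := by linarith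
    rw [r4, r1, r2, hh1n2, r3]
    ring
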